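/- arXiv:math/0207142 — 3 statements merged into one kernel-verified Lean document; each statement's English description precedes it below -/
import Mathlib

section
/- Fix an integer r ≥ 1 and let E_r = (2^{−1}I_r) ∪ I_r ∪ J_r ∪ (I_r + 2^{r+2}π). For almost every ξ ∈ I_r: ξ + 2kπ ∈ E_r (k ∈ ℤ) if and only if k = 0 or k = 2^{r+1}, and 2^j ξ ∈ E_r (j ∈ ℤ) if and only if j = 0 or j = −1. -/
open MeasureTheory Set Filter Topology
open scoped ENNReal Real

noncomputable section

/-- `t_r = 2^{r+1}π/(2^{r+1}-1)`. -/
def tPt (r : ℕ) : ℝ := 2 ^ (r + 1) * π / (2 ^ (r + 1) - 1)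

/-- `I_r = [t_r, 2π]`. -/
def Ir (r : ℕ) : Set ℝ := Icc (tPt r) (2 * π)

/-- `J_r = [2^{r+1}π, 2^{r+1}t_r]`. -/
def Jr (r : ℕ) : Set ℝ := Icc (2 ^ (r + 1) * π) (2 ^ (r + 1) * tPt r)

/-- `A + c = {a + c : a ∈ A}`. -/
def shift (A : Set ℝ) (c : ℝ) : Set ℝ := (fun x => x + c) '' A

/-- `c A = {c a : a ∈ A}`. -/
def scale (c : ℝ) (A : Set ℝ) : Set ℝ := (fun x => c * x) '' A

/-- `E_r = (2^{-1}I_r) ∪ I_r ∪ J_r ∪ (I_r + 2^{r+2}π)`, the support of `𝓕ψ_r`. -/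
def Er (r : ℕ) : Set ℝ :=
  scale 2⁻¹ (Ir r) ∪ Ir r ∪ Jr r ∪ shift (Ir r) (2 ^ (r + 2) * π)

lemma aux_zpow (m : ℤ) : (m ≤ -1 ∧ (2:ℝ) ^ m ≤ 1 / 2) ∨ (m = 0 ∧ (2:ℝ) ^ m = 1) ∨
    (1 ≤ m ∧ (2:ℝ) ≤ 2 ^ m) := by
  rcases lt_trichotomy m 0 with h | h | h
  · left
    refine ⟨by omega, ?_⟩
    have := zpow_le_zpow_right₀ (a := (2:ℝ)) (by norm_num) (show m ≤ -1 by omega)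
    norm_num at this ⊢
    exact this
  · right; left
    subst h
    simp
  · right; right
    refine ⟨by omega, ?_⟩
    have := zpow_le_zpow_right₀ (a := (2:ℝ)) (by norm_num) (show 1 ≤ m by omega)
    simpa using this

lemma mem_Er (r : ℕ) (x : ℝ) : x ∈ Er r ↔
    (tPt r ≤ 2 * x ∧ 2 * x ≤ 2 * π) ∨ (tPt r ≤ x ∧ x ≤ 2 * π) ∨
    (2 ^ (r + 1) * π ≤ x ∧ x ≤ 2 ^ (r + 1) * tPt r) ∨
    (tPt r ≤ x - 2 ^ (r + 2) * π ∧ x - 2 ^ (r + 2) * π ≤ 2 * π) := by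
  have h1 : x ∈ scale 2⁻¹ (Ir r) ↔ (tPt r ≤ 2 * x ∧ 2 * x ≤ 2 * π) := by
    constructor
    · rintro ⟨y, ⟨hy1, hy2⟩, rfl⟩
      constructor <;> simp only <;> linarith
    · rintro ⟨a, b⟩
      exact ⟨2 * x, ⟨a, b⟩, by simp⟩
  have h2 : x ∈ shift (Ir r) (2 ^ (r + 2) * π) ↔
      (tPt r ≤ x - 2 ^ (r + 2) * π ∧ x - 2 ^ (r + 2) * π ≤ 2 * π) := by
    constructor
    · rintro ⟨y, ⟨hy1, hy2⟩, rfl⟩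
      constructor <;> simp only <;> linarith
    · rintro ⟨a, b⟩
      exact ⟨x - 2 ^ (r + 2) * π, ⟨a, b⟩, by simp⟩
  unfold Er
  rw [mem_union, mem_union, mem_union, h1, h2, or_assoc, or_assoc]
  rfl

/-- For a.e. `ξ ∈ I_r`: `ξ + 2kπ ∈ E_r` iff `k = 0` or `k = 2^{r+1}`, and `2^j ξ ∈ E_r` iff `j = 0` or `j = -1`. -/
theorem lemma_one_ii (r : ℕ) (hr : 1 ≤ r) :
    ∀ᵐ ξ : ℝ, ξ ∈ Ir r →
      ((∀ k : ℤ, ξ + 2 * (k : ℝ) * π ∈ Er r ↔ (k = 0 ∨ k = 2 ^ (r + 1))) ∧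
       (∀ j : ℤ, (2 : ℝ) ^ j * ξ ∈ Er r ↔ (j = 0 ∨ j = -1))) := by
  have hne : ∀ a : ℝ, ∀ᵐ ξ : ℝ, ξ ≠ a := fun a => by
    simp [ae_iff]
  filter_upwards [hne (tPt r), hne (2 * π)] with ξ hξ1 hξ2 hI
  have hlo : tPt r < ξ := lt_of_le_of_ne hI.1 (Ne.symm hξ1)
  have hhi : ξ < 2 * π := lt_of_le_of_ne hI.2 hξ2
  have hπ := Real.pi_pos
  obtain ⟨M, hM⟩ : ∃ M : ℤ, M = 2 ^ r := ⟨_, rfl⟩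
  have hMR : (M : ℝ) = 2 ^ r := by rw [hM]; push_cast; rfl
  have hM2 : 2 ≤ M := by
    rw [hM]
    calc (2:ℤ) = 2 ^ 1 := by norm_num
      _ ≤ 2 ^ r := pow_le_pow_right₀ (by norm_num) hr
  have hM2R : (2:ℝ) ≤ M := by exact_mod_cast hM2
  have e1 : (2:ℝ) ^ (r + 1) = 2 * M := by rw [hMR]; ring
  have e2 : (2:ℝ) ^ (r + 2) = 4 * M := by rw [hMR]; ring
  have e3 : (2:ℤ) ^ (r + 1) = 2 * M := by rw [hM]; ring
  have ht : 2 * M * tPt r = 2 * M * π + tPt r := by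
    have : (2 * M - 1 : ℝ) ≠ 0 := by linarith
    unfold tPt
    rw [e1]
    field_simp
    ring
  have htπ : π < tPt r := by
    by_contra h
    push Not at h
    nlinarith
  refine ⟨fun k => ?_, fun j => ?_⟩
  · rw [mem_Er, e1, e2, e3, ht]
    generalize tPt r = t at *
    -- integer comparison helper
    have key : ∀ a : ℤ, (a:ℝ) * π < (0:ℝ) → a < 0 := fun a h => by
      by_contra h'
      have : (0:ℝ) ≤ a := by exact_mod_cast (not_lt.mp h')
      nlinarith
    constructor
    · rintro (⟨h1, h2⟩ | ⟨h1, h2⟩ | ⟨h1, h2⟩ | ⟨h1, h2⟩)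
      · have a1 := key k (by linarith)
        have a2 := key (-k - 1) (by push_cast; linarith)
        omega
      · have a1 := key (k - 1) (by push_cast; linarith)
        have a2 := key (-k - 1) (by push_cast; linarith)
        omega
      · have a1 := key (k - M) (by push_cast; linarith)
        have a2 := key (M - k - 1) (by push_cast; linarith)
        omega
      · have a1 := key (k - 2 * M - 1) (by push_cast; linarith)
        have a2 := key (2 * M - k - 1) (by push_cast; linarith)
        omega
    · rintro (h | h)
      · subst h
        right; left
        constructor <;> push_cast <;> linarith
      · subst h
        right; right; right
        constructor <;> push_cast <;> linarith
  · rw [mem_Er, e1, e2]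
    constructor
    · rintro (⟨h1, h2⟩ | ⟨h1, h2⟩ | ⟨h1, h2⟩ | ⟨h1, h2⟩)
      · right
        have e : (2:ℝ) ^ (j + 1) = 2 * 2 ^ j := by
          rw [zpow_add₀ (by norm_num)]; ring
        rw [← mul_assoc, ← e] at h1 h2
        rcases aux_zpow (j + 1) with ⟨_, h⟩ | ⟨h, _⟩ | ⟨_, h⟩
        · nlinarith
        · omega
        · nlinarith
      · left
        rcases aux_zpow j with ⟨_, h⟩ | ⟨h, _⟩ | ⟨_, h⟩
        · nlinarith
        · exact h
        · nlinarith
      · exfalso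
        have e : (2:ℝ) ^ j = 2 * M * 2 ^ (j - (r + 1 : ℕ)) := by
          rw [← e1, ← zpow_natCast, ← zpow_add₀ (by norm_num)]; congr 1; ring
        rw [e, mul_assoc (2 * (M:ℝ))] at h1 h2
        have h1 := le_of_mul_le_mul_left h1 (by linarith)
        have h2 := le_of_mul_le_mul_left h2 (by linarith)
        rcases aux_zpow (j - (r + 1 : ℕ)) with ⟨_, h⟩ | ⟨_, h⟩ | ⟨_, h⟩
        · nlinarith
        · rw [h] at h2; linarith
        · nlinarith
      · exfalso
        have e : (2:ℝ) ^ j = 4 * M * 2 ^ (j - (r + 2 : ℕ)) := by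
          rw [← e2, ← zpow_natCast, ← zpow_add₀ (by norm_num)]; congr 1; ring
        rw [e, mul_assoc] at h1 h2
        have hlt : 4 * M * (2 ^ (j - (r + 2 : ℕ)) * ξ) < 4 * M * tPt r := by
          linarith
        have hgt : 4 * M * π < 4 * M * (2 ^ (j - (r + 2 : ℕ)) * ξ) := by
          linarith
        have h1 := lt_of_mul_lt_mul_left hgt (by linarith)
        have h2 := lt_of_mul_lt_mul_left hlt (by linarith)
        rcases aux_zpow (j - (r + 2 : ℕ)) with ⟨_, h⟩ | ⟨_, h⟩ | ⟨_, h⟩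
        · nlinarith
        · rw [h] at h2; linarith
        · nlinarith
    · rintro (h | h)
      · subst h
        right; left
        simp only [zpow_zero, one_mul]
        exact ⟨hlo.le, hhi.le⟩
      · subst h
        left
        norm_num
        exact ⟨by linarith, by linarith⟩
end
end

section
/- Fix an integer r ≥ 1 and let E_r = (2^{−1}I_r) ∪ I_r ∪ J_r ∪ (I_r + 2^{r+2}π). For almost every ξ ∈ I_r + 2^{r+2}π: ξ + 2kπ ∈ E_r (k ∈ ℤ) if and only if k = 0 or k = −2^{r+1}, and 2^j ξ ∈ E_r (j ∈ ℤ) if and only if j = 0 or j = −1. -/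
open MeasureTheory Set Filter Topology
open scoped ENNReal Real

noncomputable section

lemma mem_Er_iff (r : ℕ) (y : ℝ) : y ∈ Er r ↔
    (tPt r ≤ 2 * y ∧ y ≤ π) ∨ (tPt r ≤ y ∧ y ≤ 2 * π) ∨
    (2 ^ (r + 1) * π ≤ y ∧ y ≤ 2 ^ (r + 1) * tPt r) ∨
    (tPt r + 2 ^ (r + 2) * π ≤ y ∧ y ≤ 2 * π + 2 ^ (r + 2) * π) := by
  have h1 : y ∈ scale 2⁻¹ (Ir r) ↔ (tPt r ≤ 2 * y ∧ y ≤ π) := by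
    constructor
    · rintro ⟨x, ⟨h1, h2⟩, rfl⟩
      constructor <;> dsimp only <;> linarith
    · rintro ⟨h1, h2⟩
      exact ⟨2 * y, ⟨h1, by linarith⟩, by dsimp only; ring⟩
  have h2 : y ∈ shift (Ir r) (2 ^ (r + 2) * π) ↔
      (tPt r + 2 ^ (r + 2) * π ≤ y ∧ y ≤ 2 * π + 2 ^ (r + 2) * π) := by
    constructor
    · rintro ⟨x, ⟨h1, h2⟩, rfl⟩
      constructor <;> dsimp only <;> linarith
    · rintro ⟨h1, h2⟩
      exact ⟨y - 2 ^ (r + 2) * π, ⟨by linarith, by linarith⟩, by dsimp only; ring⟩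
  unfold Er
  rw [mem_union, mem_union, mem_union, h1, h2, Ir, Jr, mem_Icc, mem_Icc, or_assoc, or_assoc]

lemma int_mul_pi_cases (a x : ℝ) (m : ℤ) (h : a = x + 2 * m * π) :
    m = 0 ∨ a ≤ x - 2 * π ∨ x + 2 * π ≤ a := by
  have hp := Real.pi_pos
  rcases lt_trichotomy m 0 with h0 | h0 | h0
  · right; left
    have : (m : ℝ) ≤ -1 := by exact_mod_cast (by omega : m ≤ -1)
    nlinarith
  · exact Or.inl h0
  · right; right
    have : (1 : ℝ) ≤ m := by exact_mod_cast (by omega : 1 ≤ m)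
    nlinarith

lemma not_dil (r s : ℕ) (t ξ : ℝ) (hpt : π < t) (hNt : 2 ^ (r + 1) * t = 2 ^ (r + 1) * π + t)
    (h1 : t + 2 ^ (r + 2) * π < ξ) (h2 : ξ < 2 * π + 2 ^ (r + 2) * π)
    (h3 : 2 ^ s * t ≤ ξ) (h4 : ξ ≤ 2 ^ s * (2 * π)) : False := by
  have hp := Real.pi_pos
  rcases le_or_gt s (r + 1) with h | h
  · have : (2 : ℝ) ^ s ≤ 2 ^ (r + 1) := pow_le_pow_right₀ (by norm_num) h
    have e : (2 : ℝ) ^ (r + 2) = 2 * 2 ^ (r + 1) := by ring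
    rw [e] at h1
    nlinarith
  · have : (2 : ℝ) ^ (r + 2) ≤ 2 ^ s := pow_le_pow_right₀ (by norm_num) h
    have e : (2 : ℝ) ^ (r + 2) = 2 * 2 ^ (r + 1) := by ring
    have := mul_le_mul_of_nonneg_right this (by linarith : 0 ≤ t)
    rw [e] at this h2
    nlinarith

/-- For a.e. `ξ ∈ I_r + 2^{r+2}π`: `ξ + 2kπ ∈ E_r` iff `k = 0` or `k = -2^{r+1}`, and `2^j ξ ∈ E_r` iff `j = 0` or `j = -1`. -/
theorem lemma_one_v (r : ℕ) (hr : 1 ≤ r) :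
    ∀ᵐ ξ : ℝ, ξ ∈ shift (Ir r) (2 ^ (r + 2) * π) →
      ((∀ k : ℤ, ξ + 2 * (k : ℝ) * π ∈ Er r ↔ (k = 0 ∨ k = -(2 ^ (r + 1)))) ∧
       (∀ j : ℤ, (2 : ℝ) ^ j * ξ ∈ Er r ↔ (j = 0 ∨ j = -1))) := by
  have hp := Real.pi_pos
  have hN : (4 : ℝ) ≤ 2 ^ (r + 1) := by
    have : (2 : ℝ) ^ 2 ≤ 2 ^ (r + 1) := pow_le_pow_right₀ (by norm_num) (by omega)
    linarith
  have hNt : 2 ^ (r + 1) * tPt r = 2 ^ (r + 1) * π + tPt r := by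
    have : (2 : ℝ) ^ (r + 1) - 1 ≠ 0 := by linarith
    unfold tPt
    field_simp
    ring
  have hpt : π < tPt r := by nlinarith
  have ht2 : tPt r < 2 * π := by nlinarith
  have e2 : (2 : ℝ) ^ (r + 2) = 2 * 2 ^ (r + 1) := by ring
  have hne : ∀ c : ℝ, ∀ᵐ ξ : ℝ, ξ ≠ c := fun c => by
    simp [ae_iff]
  filter_upwards [hne (tPt r + 2 ^ (r + 2) * π), hne (2 * π + 2 ^ (r + 2) * π)] with ξ n1 n2 hξ
  obtain ⟨x, ⟨hx1, hx2⟩, rfl⟩ := hξ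
  dsimp only at n1 n2 ⊢
  have hx1 : tPt r < x := lt_of_le_of_ne hx1 (fun h => n1 (by rw [h]))
  have hx2 : x < 2 * π := lt_of_le_of_ne hx2 (fun h => n2 (by rw [h]))
  clear n1 n2
  refine ⟨fun k => ?_, fun j => ?_⟩
  · rw [mem_Er_iff]
    set y := x + 2 ^ (r + 2) * π + 2 * (k : ℝ) * π with hy
    have c0 := int_mul_pi_cases y (x + 2 ^ (r + 2) * π) k hy
    have c1 := int_mul_pi_cases y x (k + 2 ^ (r + 1)) (by rw [hy]; push_cast; rw [e2]; ring)
    have c2 := int_mul_pi_cases y (x + 2 ^ (r + 1) * π) (k + 2 ^ r) (by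
      rw [hy]; push_cast; ring)
    constructor
    · rintro (⟨h1, h2⟩ | ⟨h1, h2⟩ | ⟨h1, h2⟩ | ⟨h1, h2⟩)
      · exfalso
        rcases c1 with c | c | c
        · have hc : (k : ℝ) = - 2 ^ (r + 1) := by
            have : k = - 2 ^ (r + 1) := by linarith
            rw [this]; push_cast; ring
          rw [hc, e2] at hy
          have : y = x := by rw [hy]; ring
          linarith
        · linarith
        · linarith
      · rcases c1 with c | c | c
        · right; linarith
        · linarith
        · linarith
      · exfalso
        rw [hNt] at h2
        rcases c2 with c | c | c
        · have hc : (k : ℝ) = - 2 ^ r := by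
            have : k = - 2 ^ r := by linarith
            rw [this]; push_cast; ring
          have : y = x + 2 ^ (r + 1) * π := by rw [hy, hc]; ring
          linarith
        · linarith
        · linarith
      · rcases c0 with c | c | c
        · left; exact c
        · linarith
        · linarith
    · rintro (h | h)
      · right; right; right
        have : y = x + 2 ^ (r + 2) * π := by rw [hy, h]; simp
        constructor <;> linarith
      · right; left
        have : y = x := by rw [hy, h, e2]; push_cast; ring
        constructor <;> linarith
  · set ξ := x + 2 ^ (r + 2) * π with hξ
    have g1 : tPt r + 2 ^ (r + 2) * π < ξ := by linarith
    have g2 : ξ < 2 * π + 2 ^ (r + 2) * π := by linarith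
    have hNp : 4 * π ≤ 2 ^ (r + 1) * π := by nlinarith
    have e3 : (2 : ℝ) ^ (r + 2) * π = 2 * (2 ^ (r + 1) * π) := by ring
    rw [mem_Er_iff]
    constructor
    · intro h
      by_contra hj
      rcases (by omega : 1 ≤ j ∨ j ≤ -2) with hj | hj
      · have : (2 : ℝ) ^ (1 : ℤ) ≤ 2 ^ j := zpow_le_zpow_right₀ (by norm_num) hj
        rw [zpow_one] at this
        have : 2 * ξ ≤ 2 ^ j * ξ := mul_le_mul_of_nonneg_right this (by linarith)
        rcases h with ⟨h1, h2⟩ | ⟨h1, h2⟩ | ⟨h1, h2⟩ | ⟨h1, h2⟩ <;> linarith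
      · obtain ⟨s, hs⟩ : ∃ s : ℕ, j = -((s : ℤ) + 2) := ⟨(-j - 2).toNat, by omega⟩
        set y := (2 : ℝ) ^ j * ξ with hy
        have hyξ : ξ = 2 ^ (s + 2) * y := by
          have : (2 : ℝ) ^ j = (2 ^ (s + 2))⁻¹ := by
            rw [hs, zpow_neg]; norm_cast
          rw [hy, this]
          field_simp
        have hs1 : (1 : ℝ) ≤ 2 ^ s := one_le_pow₀ (by norm_num)
        have e4 : (2 : ℝ) ^ (s + 2) = 4 * 2 ^ s := by ring
        have hy4 : 0 ≤ y → 4 * y ≤ ξ := fun h => by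
          rw [hyξ, e4]; nlinarith
        have hs0 : (0 : ℝ) ≤ 2 ^ (s + 1) := by positivity
        have hs2 : (0 : ℝ) ≤ 2 ^ (s + 2) := by positivity
        have e5 : ξ = 2 ^ (s + 1) * (2 * y) := by rw [hyξ]; ring
        rcases h with ⟨h1, h2⟩ | ⟨h1, h2⟩ | ⟨h1, h2⟩ | ⟨h1, h2⟩
        · refine not_dil r (s + 1) (tPt r) ξ hpt hNt g1 g2 ?_ ?_
          · rw [e5]; exact mul_le_mul_of_nonneg_left h1 hs0
          · rw [e5]; exact mul_le_mul_of_nonneg_left (by linarith) hs0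
        · refine not_dil r (s + 2) (tPt r) ξ hpt hNt g1 g2 ?_ ?_
          · rw [hyξ]; exact mul_le_mul_of_nonneg_left h1 hs2
          · rw [hyξ]; exact mul_le_mul_of_nonneg_left h2 hs2
        · have := hy4 (by linarith)
          linarith
        · have := hy4 (by linarith)
          linarith
    · rintro (rfl | rfl)
      · right; right; right
        rw [zpow_zero, one_mul]
        constructor <;> linarith
      · right; right; left
        rw [zpow_neg_one, hNt]
        constructor <;> linarith
end
end

section
/- Fix an integer r ≥ 1 and let ψ_r be the function whose Fourier transform is 𝓕ψ_r = 1/√2 on I_r ∪ (2^{−1}I_r) ∪ (2^{−1}I_r + 2^{r+1}π), 𝓕ψ_r = −1/√2 on I_r + 2^{r+2}π, 𝓕ψ_r = 1 on J_r \ (2^{−1}I_r + 2^{r+1}π), and 𝓕ψ_r = 0 elsewhere. With E = {ξ : 𝓕ψ_r(ξ) ≠ 0}, the set 𝓔_{ψ_r} = {k ∈ ℤ : {ξ ∈ E : ξ + 2kπ ∈ E} has positive Lebesgue measure} equals {0, 2^r, −2^r, 2^{r+1}, −2^{r+1}}. -/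
open MeasureTheory Set Filter Topology
open scoped ENNReal Real

noncomputable section

open Classical in
/-- The function equal to `1/√2` on `I_r ∪ (2^{-1}I_r) ∪ (2^{-1}I_r + 2^{r+1}π)`,
to `-1/√2` on `I_r + 2^{r+2}π`, to `1` on `J_r \ (2^{-1}I_r + 2^{r+1}π)`,
and to `0` elsewhere. -/
def waveletProfile (r : ℕ) : ℝ → ℝ := fun ξ =>
  if ξ ∈ Ir r ∪ scale 2⁻¹ (Ir r) ∪ shift (scale 2⁻¹ (Ir r)) (2 ^ (r + 1) * π) then
    1 / Real.sqrt 2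
  else if ξ ∈ shift (Ir r) (2 ^ (r + 2) * π) then -(1 / Real.sqrt 2)
  else if ξ ∈ Jr r \ shift (scale 2⁻¹ (Ir r)) (2 ^ (r + 1) * π) then 1
  else 0

lemma tPt_facts (r : ℕ) (hr : 1 ≤ r) : π < tPt r ∧ tPt r < 2 * π ∧
    (2 ^ (r + 1)) * tPt r = 2 * (2 ^ r * π) + tPt r ∧ 2 * π ≤ 2 ^ r * π := by
  have hp := Real.pi_pos
  have hM : (2 : ℝ) ≤ 2 ^ r := by
    calc (2 : ℝ) = 2 ^ 1 := by norm_num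
      _ ≤ 2 ^ r := pow_le_pow_right₀ (by norm_num) hr
  have hN : (2 : ℝ) ^ (r + 1) = 2 * 2 ^ r := by ring
  unfold tPt
  rw [hN]
  generalize (2 : ℝ) ^ r = M at *
  have h0 : 0 < 2 * M - 1 := by linarith
  refine ⟨?_, ?_, ?_, ?_⟩
  · rw [lt_div_iff₀ h0]; nlinarith
  · rw [div_lt_iff₀ h0]; nlinarith
  · field_simp; ring
  · nlinarith

lemma profile_ne_zero (r : ℕ) (hr : 1 ≤ r) (x : ℝ) : waveletProfile r x ≠ 0 ↔
    (tPt r ≤ x ∧ x ≤ 2 * π) ∨ (tPt r ≤ 2 * x ∧ x ≤ π) ∨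
    (2 * (2 ^ r * π) ≤ x ∧ x ≤ 2 * (2 ^ r * π) + tPt r) ∨
    (4 * (2 ^ r * π) + tPt r ≤ x ∧ x ≤ 4 * (2 ^ r * π) + 2 * π) := by
  obtain ⟨h1, h2, h3, h4⟩ := tPt_facts r hr
  have hp := Real.pi_pos
  have hs : (1 / Real.sqrt 2) ≠ 0 := by positivity
  have hN : (2 : ℝ) ^ (r + 1) * π = 2 * (2 ^ r * π) := by ring
  have hN2 : (2 : ℝ) ^ (r + 2) * π = 4 * (2 ^ r * π) := by ring
  have eA : x ∈ Ir r ↔ (tPt r ≤ x ∧ x ≤ 2 * π) := Iff.rfl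
  have eB : ∀ y, y ∈ scale 2⁻¹ (Ir r) ↔ (tPt r ≤ 2 * y ∧ y ≤ π) := by
    intro y
    constructor
    · rintro ⟨z, ⟨hz1, hz2⟩, rfl⟩
      constructor <;> dsimp only <;> linarith
    · rintro ⟨a, b⟩
      exact ⟨2 * y, ⟨a, by linarith⟩, by simp⟩
  have eS : ∀ (A : Set ℝ) (c y : ℝ), y ∈ shift A c ↔ y - c ∈ A := by
    intro A c y
    constructor
    · rintro ⟨z, hz, rfl⟩
      simpa using hz
    · intro h
      exact ⟨y - c, h, by simp⟩
  have eD : x ∈ shift (Ir r) (2 ^ (r + 2) * π) ↔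
      (4 * (2 ^ r * π) + tPt r ≤ x ∧ x ≤ 4 * (2 ^ r * π) + 2 * π) := by
    rw [eS, hN2]
    constructor
    · rintro ⟨a, b⟩
      constructor <;> linarith
    · rintro ⟨a, b⟩
      constructor <;> linarith
  have eC : x ∈ Jr r ↔ (2 * (2 ^ r * π) ≤ x ∧ x ≤ 2 * (2 ^ r * π) + tPt r) := by
    unfold Jr
    rw [h3, hN, mem_Icc]
  have hsub : x ∈ shift (scale 2⁻¹ (Ir r)) (2 ^ (r + 1) * π) → x ∈ Jr r := by
    rw [eS, eB, hN, eC]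
    rintro ⟨a, b⟩
    constructor <;> linarith
  rw [← eA, ← eB, ← eC, ← eD]
  unfold waveletProfile
  split_ifs with a b c
  all_goals simp only [Set.mem_union, Set.mem_sdiff] at *
  · simp only [ne_eq, hs, not_false_eq_true, true_iff]; tauto
  · simp only [ne_eq, neg_eq_zero, hs, not_false_eq_true, true_iff]; tauto
  · simp only [ne_eq, one_ne_zero, not_false_eq_true, true_iff]; tauto
  · simp only [ne_eq, not_true_eq_false, false_iff]; tauto

/-- With `E = supp 𝓕ψ_r`, the set
`𝓔_{ψ_r} = {k ∈ ℤ : |{ξ ∈ E : ξ + 2kπ ∈ E}| > 0}` equals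
`{0, 2^r, -2^r, 2^{r+1}, -2^{r+1}}`. -/
theorem translation_support_set_of_nonMSF_wavelet (r : ℕ) (hr : 1 ≤ r) :
    {k : ℤ | 0 < volume {ξ : ℝ |
        waveletProfile r ξ ≠ 0 ∧ waveletProfile r (ξ + 2 * (k : ℝ) * π) ≠ 0}}
      = {0, 2 ^ r, -(2 ^ r), 2 ^ (r + 1), -(2 ^ (r + 1))} := by
  obtain ⟨h1, h2, h3, h4⟩ := tPt_facts r hr
  have hp := Real.pi_pos
  simp only [profile_ne_zero r hr]
  have hM : ((2 ^ r : ℤ) : ℝ) = 2 ^ r := by push_cast; rfl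
  have hN : (2 : ℤ) ^ (r + 1) = 2 * 2 ^ r := by ring
  rw [hN]
  clear h3 hr
  generalize tPt r = t at *
  rw [← hM] at h4 ⊢
  clear hM hN
  generalize (2 : ℤ) ^ r = M at *
  have key : ∀ (a b : ℝ) (S : Set ℝ), a < b → Icc a b ⊆ S → 0 < volume S := by
    intro a b S hab hS
    refine lt_of_lt_of_le ?_ (measure_mono hS)
    rw [Real.volume_Icc]
    simpa using hab
  have mulle : ∀ a b : ℤ, a ≤ b → (a : ℝ) * π ≤ b * π := by
    intro a b h
    have : (a : ℝ) ≤ b := by exact_mod_cast h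
    nlinarith
  ext k
  simp only [Set.mem_ofPred_eq, mem_insert_iff, mem_singleton_iff]
  constructor
  · intro hk
    by_contra! hne
    obtain ⟨n0, n1, n2, n3, n4⟩ := hne
    apply hk.ne'
    refine measure_mono_null (t := {2 * π, 2 * (M * π), 4 * (M * π) + 2 * π}) ?_
      (Set.Finite.measure_zero (Set.toFinite _) _)
    have hcases : k ≤ -(2 * M) - 1 ∨ (-(2 * M) + 1 ≤ k ∧ k ≤ -M - 1) ∨
      (-M + 1 ≤ k ∧ k ≤ -1) ∨ (1 ≤ k ∧ k ≤ M - 1) ∨ (M + 1 ≤ k ∧ k ≤ 2 * M - 1) ∨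
      2 * M + 1 ≤ k := by omega
    rintro x ⟨hx, hy⟩
    simp only [mem_insert_iff, mem_singleton_iff]
    have hk2 : x + 2 * (k : ℝ) * π = x + 2 * (k * π) := by ring
    rw [hk2] at hy
    rcases hcases with c | ⟨c, d⟩ | ⟨c, d⟩ | ⟨c, d⟩ | ⟨c, d⟩ | c
    all_goals
      have c' := mulle _ _ c
      try have d' := mulle _ _ d
      push_cast at *
      simp only [add_mul, sub_mul, neg_mul, one_mul, mul_assoc] at *
      generalize (k : ℝ) * π = K at *
      generalize (M : ℝ) * π = L at *
      rcases hx with ⟨a, b⟩ | ⟨a, b⟩ | ⟨a, b⟩ | ⟨a, b⟩ <;>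
      rcases hy with ⟨e, f⟩ | ⟨e, f⟩ | ⟨e, f⟩ | ⟨e, f⟩ <;>
      first
      | (exfalso; linarith)
      | (left; linarith)
      | (right; left; linarith)
      | (right; right; linarith)
  · rintro (rfl | rfl | rfl | rfl | rfl)
    · refine key t (2 * π) _ h2 ?_
      rintro x ⟨a, b⟩
      refine ⟨Or.inl ⟨a, b⟩, Or.inl ?_⟩
      push_cast
      constructor <;> linarith
    · refine key (t / 2) π _ (by linarith) ?_
      rintro x ⟨a, b⟩
      refine ⟨Or.inr (Or.inl ⟨by linarith, b⟩), Or.inr (Or.inr (Or.inl ?_))⟩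
      constructor <;> linarith
    · refine key (t / 2 + 2 * (M * π)) (π + 2 * (M * π)) _ (by linarith) ?_
      rintro x ⟨a, b⟩
      refine ⟨Or.inr (Or.inr (Or.inl ⟨by linarith, by linarith⟩)), Or.inr (Or.inl ?_)⟩
      push_cast
      constructor <;> linarith
    · refine key t (2 * π) _ h2 ?_
      rintro x ⟨a, b⟩
      refine ⟨Or.inl ⟨a, b⟩, Or.inr (Or.inr (Or.inr ?_))⟩
      push_cast
      constructor <;> linarith
    · refine key (4 * (M * π) + t) (4 * (M * π) + 2 * π) _ (by linarith) ?_
      rintro x ⟨a, b⟩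
      refine ⟨Or.inr (Or.inr (Or.inr ⟨a, b⟩)), Or.inl ?_⟩
      push_cast
      constructor <;> linarith
end
end
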